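/- There exists a set X ⊆ ℕ such that WF = {e : T_e is well-founded} is c.e. in X, but X is not loquaciously high for paths. (In the paper's terms: there is a degree that enumerates Kleene's O but is not loquaciously high for paths; WF is a Π¹₁-complete set playing the role of O.) -/

import Mathlib

namespace CFT

open Nat.Partrec (Code)

/-- Relativized partial recursive functions: `f` is partial recursive in the
(total) oracle `O : ℕ → ℕ`.  This mirrors Mathlib's `Nat.Partrec`, with an
extra constructor for the oracle. -/
inductive RecursiveIn (O : ℕ → ℕ) : (ℕ →. ℕ) → Prop
  | zero : RecursiveIn O (pure 0)
  | succ : RecursiveIn O Nat.succ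
  | left : RecursiveIn O ↑fun n : ℕ => n.unpair.1
  | right : RecursiveIn O ↑fun n : ℕ => n.unpair.2
  | oracle : RecursiveIn O ↑O
  | pair {f g} : RecursiveIn O f → RecursiveIn O g →
      RecursiveIn O fun n => Nat.pair <$> f n <*> g n
  | comp {f g} : RecursiveIn O f → RecursiveIn O g →
      RecursiveIn O fun n => g n >>= f
  | prec {f g} : RecursiveIn O f → RecursiveIn O g →
      RecursiveIn O (Nat.unpaired fun a n =>
        n.rec (f a) fun y IH => do let i ← IH; g (Nat.pair a (Nat.pair y i)))
  | rfind {f} : RecursiveIn O f →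
      RecursiveIn O fun a => Nat.rfind fun n => (fun m => m = 0) <$> f (Nat.pair a n)

/-- Partial functions between `Primcodable` types that are partial recursive in
the oracle `O`. -/
def PartrecIn (O : ℕ → ℕ) {α σ : Type} [Primcodable α] [Primcodable σ] (f : α →. σ) : Prop :=
  RecursiveIn O fun n =>
    Part.bind (Part.ofOption (Encodable.decode (α := α) n)) fun a => (f a).map Encodable.encode

/-- Total functions between `Primcodable` types that are computable in the oracle `O`. -/
def ComputableIn (O : ℕ → ℕ) {α σ : Type} [Primcodable α] [Primcodable σ] (f : α → σ) : Prop :=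
  PartrecIn O (f : α →. σ)

open Classical in
/-- The characteristic function of a set of naturals. -/
noncomputable def chi (A : Set ℕ) : ℕ → ℕ := fun n => if n ∈ A then 1 else 0

/-- `A` is computably enumerable in (the characteristic function of) `X`. -/
def CEIn (X : Set ℕ) (A : Set ℕ) : Prop :=
  ∃ f : ℕ →. ℕ, PartrecIn (chi X) f ∧ ∀ n, n ∈ A ↔ (f n).Dom

/-- The `e`-th partial computable function `ℕ →. ℕ`. -/
def codeFn (e : ℕ) : ℕ →. ℕ := (Denumerable.ofNat Code e).eval

/-! ### Trees on ℕ -/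

def PrefixClosed (T : Set (List ℕ)) : Prop := ∀ l ∈ T, ∀ l' : List ℕ, l' <+: l → l' ∈ T

/-- Index `e` decides a (prefix-closed) tree on `ℕ`. -/
def DecidesTree (e : ℕ) : Prop :=
  (∀ n, (codeFn e n).Dom) ∧
    PrefixClosed {l : List ℕ | codeFn e (Encodable.encode l) = Part.some 1}

open Classical in
/-- The standard enumeration of computable trees on ℕ; indices that do not
decide a tree denote the empty tree. -/
noncomputable def treeAt (e : ℕ) : Set (List ℕ) :=
  if DecidesTree e then {l : List ℕ | codeFn e (Encodable.encode l) = Part.some 1} else ∅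

/-- `f` is a path through the tree `T`: every finite initial segment
`[f 0, …, f (k-1)]` is in `T`. -/
def IsPath (T : Set (List ℕ)) (f : ℕ → ℕ) : Prop := ∀ k, (List.range k).map f ∈ T

def IllFounded (T : Set (List ℕ)) : Prop := ∃ f, IsPath T f

/-- The set of indices of well-founded computable trees. -/
def WF : Set ℕ := {e | ¬ IllFounded (treeAt e)}

/-- `T` is a computable tree (prefix-closed and decided by a total computable function). -/
def ComputableTree (T : Set (List ℕ)) : Prop :=
  PrefixClosed T ∧ ∃ χ : List ℕ → Bool, Computable χ ∧ ∀ l, l ∈ T ↔ χ l = true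

/-! ### Highness notions for paths -/

def HighForPaths (X : Set ℕ) : Prop :=
  ∀ T : Set (List ℕ), ComputableTree T → IllFounded T →
    ∃ f : ℕ → ℕ, ComputableIn (chi X) f ∧ IsPath T f

def LoqHighForPaths (X : Set ℕ) : Prop :=
  ∃ F : ℕ × ℕ → ℕ, ComputableIn (chi X) F ∧
    ∀ e, IllFounded (treeAt e) → IsPath (treeAt e) fun n => F (e, n)

def UnifHighForPaths (X : Set ℕ) : Prop :=
  ∃ F : ℕ × ℕ →. ℕ, PartrecIn (chi X) F ∧
    ∀ e, IllFounded (treeAt e) →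
      ∃ g : ℕ → ℕ, IsPath (treeAt e) g ∧ ∀ n, F (e, n) = Part.some (g n)

def RetHighForPaths (X : Set ℕ) : Prop :=
  ∃ F : ℕ × ℕ →. ℕ, PartrecIn (chi X) F ∧
    (∀ e, IllFounded (treeAt e) →
      ∃ g : ℕ → ℕ, IsPath (treeAt e) g ∧ ∀ n, F (e, n) = Part.some (g n)) ∧
    (∀ e, ¬ IllFounded (treeAt e) → ∀ n, ¬ (F (e, n)).Dom)

/-! ### Σ¹₁ and Π¹₁ sets -/

def Sigma11 (A : Set ℕ) : Prop :=
  ∃ R : ℕ → List ℕ → Bool, Computable₂ R ∧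
    ∀ n, n ∈ A ↔ ∃ f : ℕ → ℕ, ∀ k, R n ((List.range k).map f) = true

def Pi11 (A : Set ℕ) : Prop := Sigma11 Aᶜ

/-! ### Linear orders -/

/-- A (presentation of a) linear order: a domain `D ⊆ ℕ` and a strict order
relation on it. -/
structure LinOrd where
  dom : Set ℕ
  lt : ℕ → ℕ → Prop

/-- `L` really is a strict linear order on its domain. -/
def LinOrd.IsValid (L : LinOrd) : Prop :=
  (∀ a b, L.lt a b → a ∈ L.dom ∧ b ∈ L.dom) ∧
  (∀ a, ¬ L.lt a a) ∧
  (∀ a b c, L.lt a b → L.lt b c → L.lt a c) ∧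
  (∀ a ∈ L.dom, ∀ b ∈ L.dom, a = b ∨ L.lt a b ∨ L.lt b a)

def linOrdOfCodes (n : ℕ) : LinOrd :=
  ⟨{a | codeFn n.unpair.1 a = Part.some 1},
   fun a b => codeFn n.unpair.2 (Nat.pair a b) = Part.some 1⟩

def DecidesLinOrd (n : ℕ) : Prop :=
  (∀ m, (codeFn n.unpair.1 m).Dom) ∧ (∀ m, (codeFn n.unpair.2 m).Dom) ∧
    (linOrdOfCodes n).IsValid

open Classical in
/-- The standard enumeration of computable linear orders; indices that do not
decide a linear order denote the empty order. -/
noncomputable def linOrdAt (n : ℕ) : LinOrd :=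
  if DecidesLinOrd n then linOrdOfCodes n else ⟨∅, fun _ _ => False⟩

def IsDescSeq (L : LinOrd) (f : ℕ → ℕ) : Prop :=
  ∀ i, f i ∈ L.dom ∧ L.lt (f (i + 1)) (f i)

def LinOrd.IllFounded (L : LinOrd) : Prop := ∃ f, IsDescSeq L f

/-- A tight descending sequence: a descending sequence that gets below every
descending sequence. -/
def IsTightDescSeq (L : LinOrd) (f : ℕ → ℕ) : Prop :=
  IsDescSeq L f ∧ ∀ g, IsDescSeq L g → ∀ n, ∃ m, L.lt (f m) (g n)

/-- `L` is a computable linear order. -/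
def ComputableLinOrd (L : LinOrd) : Prop :=
  L.IsValid ∧
  (∃ χ : ℕ → Bool, Computable χ ∧ ∀ a, a ∈ L.dom ↔ χ a = true) ∧
  (∃ χ : ℕ → ℕ → Bool, Computable₂ χ ∧ ∀ a b, L.lt a b ↔ χ a b = true)

def LoqHighForDS (X : Set ℕ) : Prop :=
  ∃ g : ℕ × ℕ → ℕ, ComputableIn (chi X) g ∧
    ∀ n, (linOrdAt n).IllFounded → IsDescSeq (linOrdAt n) fun k => g (n, k)

def HighForTightDS (X : Set ℕ) : Prop :=
  ∀ L : LinOrd, ComputableLinOrd L → L.IllFounded →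
    ∃ f : ℕ → ℕ, ComputableIn (chi X) f ∧ IsTightDescSeq L f

def UnifHighForTightDS (X : Set ℕ) : Prop :=
  ∃ F : ℕ × ℕ →. ℕ, PartrecIn (chi X) F ∧
    ∀ n, (linOrdAt n).IllFounded →
      ∃ g : ℕ → ℕ, IsTightDescSeq (linOrdAt n) g ∧ ∀ k, F (n, k) = Part.some (g k)

/-! ### Binary trees -/

def PrefixClosedB (B : Set (List Bool)) : Prop := ∀ l ∈ B, ∀ l' : List Bool, l' <+: l → l' ∈ B

def DecidesBTree (e : ℕ) : Prop :=
  (∀ n, (codeFn e n).Dom) ∧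
    PrefixClosedB {l : List Bool | codeFn e (Encodable.encode l) = Part.some 1}

open Classical in
/-- The standard enumeration of computable binary trees; indices that do not
decide a binary tree denote the full binary tree. -/
noncomputable def bTreeAt (e : ℕ) : Set (List Bool) :=
  if DecidesBTree e then {l : List Bool | codeFn e (Encodable.encode l) = Part.some 1}
  else Set.univ

def BInfinite (B : Set (List Bool)) : Prop := ∀ k, ∃ l ∈ B, l.length = k

def IsBPath (B : Set (List Bool)) (p : ℕ → Bool) : Prop := ∀ k, (List.range k).map p ∈ B

/-- `y` extends `x` by exactly one entry. -/
def IsChild (y x : List ℕ) : Prop := y.length = x.length + 1 ∧ y.take x.length = x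

theorem isChild_iff {y x : List ℕ} : IsChild y x ↔ ∃ a, y = x ++ [a] := by
  constructor
  · rintro ⟨h1, h2⟩
    refine ⟨y[x.length], ?_⟩
    conv_lhs => rw [← List.take_append_drop x.length y, h2]
    rw [List.drop_eq_getElem_cons (by omega), List.drop_eq_nil_of_le (by omega)]
  · rintro ⟨a, rfl⟩
    simp [IsChild]

theorem isChild_append (x : List ℕ) (a : ℕ) : IsChild (x ++ [a]) x :=
  isChild_iff.2 ⟨a, rfl⟩

/-- The tree of finite sequences satisfying the local condition `Q` at all pairs of positions. -/
def LocTree (Q : ℕ × ℕ → ℕ × ℕ → Prop) (l : List ℕ) : Prop :=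
  ∀ i < l.length, ∀ j < l.length, Q (i, l.getD i 0) (j, l.getD j 0)

/-- The infinite sequences satisfying the local condition `Q` at all pairs of positions. -/
def LocPath (Q : ℕ × ℕ → ℕ × ℕ → Prop) (f : ℕ → ℕ) : Prop :=
  ∀ i j, Q (i, f i) (j, f j)

theorem getD_map_range (f : ℕ → ℕ) {k i : ℕ} (h : i < k) :
    ((List.range k).map f).getD i 0 = f i := by
  simp [List.getD, h]

theorem LocPath.locTree {Q : ℕ × ℕ → ℕ × ℕ → Prop} {f : ℕ → ℕ} (h : LocPath Q f) (k : ℕ) :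
    LocTree Q ((List.range k).map f) := by
  intro i hi j hj
  rw [List.length_map, List.length_range] at hi hj
  rw [getD_map_range f hi, getD_map_range f hj]
  exact h i j

theorem locPath_iff {Q : ℕ × ℕ → ℕ × ℕ → Prop} {f : ℕ → ℕ} :
    LocPath Q f ↔ ∀ k, LocTree Q ((List.range k).map f) := by
  refine ⟨LocPath.locTree, fun h i j => ?_⟩
  have := h (max i j + 1) i (by simp) j (by simp)
  rwa [getD_map_range f (by omega), getD_map_range f (by omega)] at this

theorem LocTree.of_prefix {Q : ℕ × ℕ → ℕ × ℕ → Prop} {l l' : List ℕ} (h : LocTree Q l)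
    (hl : l' <+: l) : LocTree Q l' := by
  obtain ⟨t, rfl⟩ := hl
  intro i hi j hj
  have := h i (by simp; omega) j (by simp; omega)
  rwa [List.getD_append _ _ _ _ hi, List.getD_append _ _ _ _ hj] at this

/-- The child relation into nodes of the tree of `Q`. -/
def TreeRel (Q : ℕ × ℕ → ℕ × ℕ → Prop) (y x : List ℕ) : Prop := LocTree Q y ∧ IsChild y x

theorem wellFounded_treeRel {Q : ℕ × ℕ → ℕ × ℕ → Prop} (h : ¬ ∃ f, LocPath Q f) :
    WellFounded (TreeRel Q) := by
  rw [wellFounded_iff_isEmpty_descending_chain]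
  refine ⟨fun ⟨x, hx⟩ => h ⟨fun i => (x (i + 1)).getD i 0, fun i j => ?_⟩⟩
  have hlen : ∀ n, n ≤ (x n).length := by
    intro n
    induction n with
    | zero => simp
    | succ n ih => have := (hx n).2.1; omega
  have hpre : ∀ m k, x m <+: x (m + k) := by
    intro m k
    induction k with
    | zero => simp
    | succ k ih =>
      obtain ⟨a, ha⟩ := isChild_iff.1 (hx (m + k)).2
      exact ih.trans (by rw [← add_assoc, ha]; exact List.prefix_append _ _)
  have hget : ∀ i N, i + 1 ≤ N → (x N).getD i 0 = (x (i + 1)).getD i 0 := by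
    intro i N hN
    obtain ⟨t, ht⟩ := hpre (i + 1) (N - (i + 1))
    rw [show i + 1 + (N - (i + 1)) = N by omega] at ht
    rw [← ht, List.getD_append _ _ _ _ (by have := hlen (i + 1); omega)]
  have hN := hlen (max i j + 1)
  have := (hx (max i j)).1 i (by omega) j (by omega)
  rwa [hget i _ (by omega), hget j _ (by omega)] at this

theorem not_exists_locPath {Q : ℕ × ℕ → ℕ × ℕ → Prop} (h : WellFounded (TreeRel Q)) :
    ¬ ∃ f, LocPath Q f := by
  rintro ⟨f, hf⟩
  rw [wellFounded_iff_isEmpty_descending_chain] at h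
  refine h.false ⟨fun n => (List.range n).map f, fun n => ⟨hf.locTree _, ?_⟩⟩
  simp only [List.range_succ, List.map_append, List.map_cons, List.map_nil]
  exact isChild_append _ _

theorem exists_rank {α : Type} {r : α → α → Prop} (h : WellFounded r) :
    ∃ ρ : α → Ordinal.{0}, (∀ y x, r y x → ρ y < ρ x) ∧
      ∀ x, ∀ o < ρ x, ∃ y, r y x ∧ o ≤ ρ y := by
  have : IsWellFounded α r := ⟨h⟩
  refine ⟨IsWellFounded.rank r, fun y x => IsWellFounded.rank_lt_of_rel, fun x o ho => ?_⟩
  rw [IsWellFounded.rank_eq, Ordinal.lt_iSup_iff] at ho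
  obtain ⟨⟨y, hy⟩, ho⟩ := ho
  exact ⟨y, hy, Order.lt_succ_iff.1 ho⟩

theorem rank_le_of_hom {α β : Type} {r : α → α → Prop} {s : β → β → Prop} (hr : WellFounded r)
    {ρ : α → Ordinal.{0}} (hρ : ∀ x, ∀ o < ρ x, ∃ y, r y x ∧ o ≤ ρ y)
    {ρ' : β → Ordinal.{0}} (hρ' : ∀ y x, s y x → ρ' y < ρ' x)
    {G : α → β} (hG : ∀ y x, r y x → s (G y) (G x)) (x : α) : ρ x ≤ ρ' (G x) := by
  induction x using hr.induction with
  | _ x ih =>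
    refine le_of_forall_lt fun o ho => ?_
    obtain ⟨y, hy, hoy⟩ := hρ x o ho
    exact (hoy.trans (ih y hy)).trans_lt (hρ' _ _ (hG y x hy))

/-- A child-preserving map on finite sequences, built by choosing children one at a time. -/
theorem exists_hom_of_rank_le {W : List ℕ → Prop} {s : List ℕ → List ℕ → Prop}
    (hW : ∀ x a, W (x ++ [a]) → W x) {ρ ρ' : List ℕ → Ordinal.{0}}
    (hρ : ∀ x a, W (x ++ [a]) → ρ (x ++ [a]) < ρ x)
    (hρ' : ∀ x, ∀ o < ρ' x, ∃ y, s y x ∧ o ≤ ρ' y) (h0 : ρ [] ≤ ρ' []) :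
    ∃ G : List ℕ → List ℕ, G [] = [] ∧ ∀ y x, IsChild y x → W y → s (G y) (G x) := by
  classical
  let next : List ℕ → List ℕ → List ℕ := fun x z =>
    if h : ∃ z', s z' z ∧ ρ x ≤ ρ' z' then h.choose else []
  let step : List ℕ × List ℕ → ℕ → List ℕ × List ℕ := fun t a =>
    (t.1 ++ [a], next (t.1 ++ [a]) t.2)
  let G : List ℕ → List ℕ := fun x => (x.foldl step ([], [])).2
  have hfst : ∀ x : List ℕ, (x.foldl step ([], [])).1 = x := by
    intro x
    induction x using List.reverseRecOn with
    | nil => rfl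
    | append_singleton x a ih => rw [List.foldl_append]; simp [step, ih]
  have hG : ∀ x a, G (x ++ [a]) = next (x ++ [a]) (G x) := by
    intro x a
    simp only [G, List.foldl_append, List.foldl_cons, List.foldl_nil]
    simp only [step]
    rw [hfst]
  have key : ∀ x a, ρ x ≤ ρ' (G x) → W (x ++ [a]) →
      s (G (x ++ [a])) (G x) ∧ ρ (x ++ [a]) ≤ ρ' (G (x ++ [a])) := by
    intro x a hx hw
    have hex := hρ' (G x) _ ((hρ x a hw).trans_le hx)
    rw [hG]
    simp only [next, dif_pos hex]
    exact hex.choose_spec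
  have inv : ∀ x, W x → ρ x ≤ ρ' (G x) := by
    intro x
    induction x using List.reverseRecOn with
    | nil => intro _; exact h0
    | append_singleton x a ih => intro hw; exact (key x a (ih (hW x a hw)) hw).2
  refine ⟨G, rfl, fun y x hyx hw => ?_⟩
  obtain ⟨a, rfl⟩ := isChild_iff.1 hyx
  exact (key x a (inv x (hW x a hw)) hw).1

/-- `G` embeds the tree of `Q` (with an extra level below the root if `c` holds) into
the tree of `P`. -/
def Emb (Q P : ℕ × ℕ → ℕ × ℕ → Prop) (c : Bool) (G : List ℕ → List ℕ) : Prop :=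
  G [] = [] ∧ ∀ y x, IsChild y x → LocTree Q (y.drop c.toNat) →
    LocTree P (G y) ∧ IsChild (G y) (G x)

theorem exists_emb_of_locPath (Q : ℕ × ℕ → ℕ × ℕ → Prop) {P : ℕ × ℕ → ℕ × ℕ → Prop} (c : Bool)
    (h : ∃ f, LocPath P f) : ∃ G, Emb Q P c G := by
  obtain ⟨f, hf⟩ := h
  refine ⟨fun x => (List.range x.length).map f, rfl, fun y x hyx _ => ⟨hf.locTree _, ?_⟩⟩
  simp only [hyx.1, List.range_succ, List.map_append, List.map_cons, List.map_nil]
  exact isChild_append _ _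

theorem exists_emb_of_rank {Q P : ℕ × ℕ → ℕ × ℕ → Prop} {c : Bool} {ρ ρ' : List ℕ → Ordinal.{0}}
    (hρ : ∀ y x, TreeRel Q y x → ρ y < ρ x)
    (hρ' : ∀ x, ∀ o < ρ' x, ∃ y, TreeRel P y x ∧ o ≤ ρ' y)
    (h : ρ [] + (if c then 1 else 0) ≤ ρ' []) : ∃ G, Emb Q P c G := by
  have hW : ∀ x a, LocTree Q ((x ++ [a]).drop c.toNat) → LocTree Q (x.drop c.toNat) :=
    fun x a hw => hw.of_prefix ((List.prefix_append x [a]).drop _)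
  cases c with
  | false =>
    exact exists_hom_of_rank_le (W := fun x => LocTree Q (x.drop (false).toNat)) hW (ρ := ρ)
      (fun x a hw => hρ _ _ ⟨hw, isChild_append _ _⟩) hρ' (by simpa using h)
  | true =>
    refine exists_hom_of_rank_le (W := fun x => LocTree Q (x.drop (true).toNat)) hW
      (ρ := fun x => if x = [] then ρ [] + 1 else ρ (x.drop 1)) (fun x a hw => ?_) hρ'
      (by simpa using h)
    cases x with
    | nil => simp
    | cons b x => simpa using hρ _ _ ⟨hw, isChild_append _ _⟩

theorem Emb.rank_le {Q P : ℕ × ℕ → ℕ × ℕ → Prop} {c : Bool} {G : List ℕ → List ℕ}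
    (hG : Emb Q P c G) {ρ' : List ℕ → Ordinal.{0}} (hP : WellFounded (TreeRel P))
    (hρ' : ∀ y x, TreeRel P y x → ρ' y < ρ' x) :
    WellFounded (TreeRel Q) ∧ ∀ ρ : List ℕ → Ordinal.{0},
      (∀ x, ∀ o < ρ x, ∃ y, TreeRel Q y x ∧ o ≤ ρ y) →
      ρ [] + (if c then 1 else 0) ≤ ρ' [] := by
  let H : List ℕ → List ℕ := fun x => G (if c then 0 :: x else x)
  have hH : ∀ y x, TreeRel Q y x → TreeRel P (H y) (H x) := by
    rintro y x ⟨hy, hyx⟩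
    obtain ⟨a, rfl⟩ := isChild_iff.1 hyx
    cases c with
    | false => exact hG.2 _ _ hyx hy
    | true => exact hG.2 (0 :: (x ++ [a])) (0 :: x) (isChild_append (0 :: x) a) hy
  have hQ : WellFounded (TreeRel Q) :=
    Subrelation.wf (fun {y x} h => hH y x h) (InvImage.wf H hP)
  refine ⟨hQ, fun ρ hρ => ?_⟩
  have h1 := rank_le_of_hom hQ hρ hρ' hH []
  cases c with
  | false => simpa [H, hG.1] using h1
  | true =>
    have h2 := hρ' _ _ (hG.2 [0] [] (isChild_append [] 0)
      (fun i hi => absurd hi (by simp)))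
    rw [hG.1] at h2
    simpa [H] using Order.add_one_le_of_lt (h1.trans_lt h2)

/-- Among the well-founded trees on which `cl` is defined, one of least rank (preferring class
`true` among ties) separates the two classes. -/
theorem exists_selected (U : ℕ → ℕ × ℕ → ℕ × ℕ → Prop) (cl : ℕ → Option Bool)
    (h : ∃ p, cl p ≠ none ∧ ¬ ∃ f, LocPath (U p) f) :
    ∃ p c, cl p = some c ∧ (¬ ∃ f, LocPath (U p) f) ∧
      (∀ q, cl q = some (!c) → ∃ G, Emb (U p) (U q) (!c) G) ∧
      ∀ q, cl q = some (!c) → ¬ ∃ G, Emb (U q) (U p) c G := by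
  classical
  have hrk : ∀ p, ∃ ρ : List ℕ → Ordinal.{0}, (¬ ∃ f, LocPath (U p) f) →
      (∀ y x, TreeRel (U p) y x → ρ y < ρ x) ∧
      ∀ x, ∀ o < ρ x, ∃ y, TreeRel (U p) y x ∧ o ≤ ρ y := by
    intro p
    by_cases hp : ∃ f, LocPath (U p) f
    · exact ⟨fun _ => 0, fun h => absurd hp h⟩
    · obtain ⟨ρ, hρ⟩ := exists_rank (wellFounded_treeRel hp)
      exact ⟨ρ, fun _ => hρ⟩
  choose ρ hρ using hrk
  let key : ℕ → Ordinal.{0} ×ₗ ℕ := fun p => toLex (ρ p [], if cl p = some true then 0 else 1)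
  obtain ⟨p, ⟨hp1, hp2⟩, hmin⟩ := WellFounded.has_min
    (InvImage.wf key (wellFounded_lt (α := Ordinal.{0} ×ₗ ℕ)))
    {p | cl p ≠ none ∧ ¬ ∃ f, LocPath (U p) f} h
  obtain ⟨c, hc⟩ := Option.ne_none_iff_exists'.1 hp1
  have hmin' : ∀ q, cl q = some (!c) → (¬ ∃ f, LocPath (U q) f) → ¬ key q < key p :=
    fun q hq hq' => hmin q ⟨by simp [hq], hq'⟩
  refine ⟨p, c, hc, hp2, fun q hq => ?_, fun q hq => ?_⟩
  · by_cases hq' : ∃ f, LocPath (U q) f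
    · exact exists_emb_of_locPath _ _ hq'
    · refine exists_emb_of_rank (hρ p hp2).1 (hρ q hq').2 ?_
      have := hmin' q hq hq'
      simp only [key, Prod.Lex.toLex_lt_toLex, hq, hc, not_or, not_lt, not_and] at this
      cases c with
      | true => simpa using this.1
      | false =>
        have h1 : ρ p [] ≠ ρ q [] := fun he => absurd (this.2 he.symm) (by simp)
        simpa using Order.add_one_le_of_lt (lt_of_le_of_ne this.1 h1)
  · rintro ⟨G, hG⟩
    obtain ⟨hwf, hle⟩ := hG.rank_le (wellFounded_treeRel hp2) (hρ p hp2).1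
    have hq' := not_exists_locPath hwf
    have hle := hle _ (hρ q hq').2
    refine hmin' q hq hq' ?_
    simp only [key, Prod.Lex.toLex_lt_toLex, hq, hc]
    cases c with
    | true => exact Or.inl (Order.add_one_le_iff.1 (by simpa using hle))
    | false =>
      rcases (show ρ q [] ≤ ρ p [] by simpa using hle).lt_or_eq with h | h
      · exact Or.inl h
      · exact Or.inr ⟨h, by simp⟩

theorem primrecPred_imp {α : Type} [Primcodable α] {p q : α → Prop} (hp : PrimrecPred p)
    (hq : PrimrecPred q) : PrimrecPred fun a => p a → q a :=
  (hp.not.or hq).of_eq fun _ => imp_iff_not_or.symm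

theorem primrecRel_isChild : PrimrecRel IsChild :=
  (Primrec.eq.comp (Primrec.list_length.comp Primrec.fst)
    (Primrec.succ.comp (Primrec.list_length.comp Primrec.snd))).and
  (Primrec.eq.comp (Primrec.list_take.comp (Primrec.list_length.comp Primrec.snd) Primrec.fst)
    Primrec.snd)

theorem primrecRel_locTree {α : Type} [Primcodable α] {Q : α → ℕ × ℕ → ℕ × ℕ → Prop}
    (hQ : PrimrecPred fun t : α × (ℕ × ℕ) × (ℕ × ℕ) => Q t.1 t.2.1 t.2.2) :
    PrimrecRel fun (a : α) (l : List ℕ) => LocTree (Q a) l := by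
  have hget : ∀ {β : Type} [Primcodable β] {u : β → List ℕ} {i : β → ℕ}, Primrec u → Primrec i →
      Primrec fun b => (i b, (u b).getD (i b) 0) := fun hu hi =>
    Primrec.pair hi ((Primrec.list_getD 0).comp hu hi)
  have h1 : PrimrecRel fun (j : ℕ) (s : ℕ × α × List ℕ) =>
      Q s.2.1 (s.1, s.2.2.getD s.1 0) (j, s.2.2.getD j 0) :=
    hQ.comp (Primrec.pair (Primrec.fst.comp (Primrec.snd.comp Primrec.snd))
      (Primrec.pair
        (hget (Primrec.snd.comp (Primrec.snd.comp Primrec.snd)) (Primrec.fst.comp Primrec.snd))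
        (hget (Primrec.snd.comp (Primrec.snd.comp Primrec.snd)) Primrec.fst)))
  have hbdd : ∀ {β : Type} [Primcodable β] {R : ℕ → β → Prop}, PrimrecRel R →
      PrimrecRel fun n b => ∀ x < n, R x b := fun hR =>
    (hR.forall_mem_list.comp (Primrec.list_range.comp Primrec.fst) Primrec.snd).of_eq (by simp)
  have h2 : PrimrecPred fun s : ℕ × α × List ℕ => ∀ j < s.2.2.length,
      Q s.2.1 (s.1, s.2.2.getD s.1 0) (j, s.2.2.getD j 0) :=
    (hbdd h1).comp (Primrec.list_length.comp (Primrec.snd.comp Primrec.snd)) Primrec.id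
  have h2' : PrimrecRel fun (i : ℕ) (s : α × List ℕ) => ∀ j < s.2.length,
      Q s.1 (i, s.2.getD i 0) (j, s.2.getD j 0) := h2
  have h4 : PrimrecPred fun s : α × List ℕ => ∀ i < s.2.length, ∀ j < s.2.length,
      Q s.1 (i, s.2.getD i 0) (j, s.2.getD j 0) :=
    (hbdd h2').comp (Primrec.list_length.comp Primrec.snd) Primrec.id
  exact h4

theorem primrec_evaln {α : Type} [Primcodable α] {k : α → ℕ} {c : α → Code} {n : α → ℕ}
    (hk : Primrec k) (hc : Primrec c) (hn : Primrec n) :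
    Primrec fun a => Nat.Partrec.Code.evaln (k a) (c a) (n a) :=
  Nat.Partrec.Code.primrec_evaln.comp (Primrec.pair (Primrec.pair hk hc) hn)

/-- The list of naturals with code `n`. -/
def listOf (n : ℕ) : List ℕ := Denumerable.ofNat (List ℕ) n

theorem listOf_encode (l : List ℕ) : listOf (Encodable.encode l) = l :=
  Denumerable.ofNat_encode l

theorem encode_listOf (n : ℕ) : Encodable.encode (listOf n) = n :=
  Denumerable.encode_ofNat n

theorem primrec_listOf : Primrec listOf := Primrec.ofNat (List ℕ)

/-- `evaln t (ofNat Code e) n`. -/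
def stepFn (t e n : ℕ) : Option ℕ := Nat.Partrec.Code.evaln t (Denumerable.ofNat Code e) n

theorem codeFn_eq_some_iff {e n v : ℕ} : codeFn e n = Part.some v ↔ ∃ t, stepFn t e n = some v := by
  rw [Part.eq_some_iff]
  exact Nat.Partrec.Code.evaln_complete

theorem eq_of_stepFn {t t' e n v w : ℕ} (h : stepFn t e n = some v) (h' : stepFn t' e n = some w) :
    v = w := by
  have h1 := codeFn_eq_some_iff.2 ⟨t, h⟩
  rw [codeFn_eq_some_iff.2 ⟨t', h'⟩] at h1
  exact (Part.some_injective h1).symm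

/-- Local condition whose solutions witness that the tree with index `e` is ill-founded.
The value at `i` is a pair of a halting time for the input `i` and a code for the first `i`
entries of a path. -/
def IllCond (e : ℕ) (a b : ℕ × ℕ) : Prop :=
  stepFn a.2.unpair.1 e a.1 ≠ none ∧
  (IsChild (listOf a.1) (listOf b.1) → stepFn a.2.unpair.1 e a.1 = some 1 →
    stepFn b.2.unpair.1 e b.1 = some 1) ∧
  (listOf a.2.unpair.2).length = a.1 ∧
  (b.1 = a.1 + 1 → IsChild (listOf b.2.unpair.2) (listOf a.2.unpair.2)) ∧
  (b.1 = a.2.unpair.2 → stepFn b.2.unpair.1 e b.1 = some 1)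

theorem primrec_stepFn {α : Type} [Primcodable α] {k c n : α → ℕ}
    (hk : Primrec k) (hc : Primrec c) (hn : Primrec n) :
    Primrec fun a => stepFn (k a) (c a) (n a) :=
  primrec_evaln hk ((Primrec.ofNat Code).comp hc) hn

theorem primrec_unpair_fst : Primrec fun n : ℕ => n.unpair.1 := Primrec.fst.comp Primrec.unpair

theorem primrec_unpair_snd : Primrec fun n : ℕ => n.unpair.2 := Primrec.snd.comp Primrec.unpair

theorem primrecPred_illCond :
    PrimrecPred fun t : ℕ × (ℕ × ℕ) × (ℕ × ℕ) => IllCond t.1 t.2.1 t.2.2 := by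
  have he : Primrec fun t : ℕ × (ℕ × ℕ) × (ℕ × ℕ) => t.1 := Primrec.fst
  have ha1 : Primrec fun t : ℕ × (ℕ × ℕ) × (ℕ × ℕ) => t.2.1.1 :=
    Primrec.fst.comp (Primrec.fst.comp Primrec.snd)
  have ha2 : Primrec fun t : ℕ × (ℕ × ℕ) × (ℕ × ℕ) => t.2.1.2 :=
    Primrec.snd.comp (Primrec.fst.comp Primrec.snd)
  have hb1 : Primrec fun t : ℕ × (ℕ × ℕ) × (ℕ × ℕ) => t.2.2.1 :=
    Primrec.fst.comp (Primrec.snd.comp Primrec.snd)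
  have hb2 : Primrec fun t : ℕ × (ℕ × ℕ) × (ℕ × ℕ) => t.2.2.2 :=
    Primrec.snd.comp (Primrec.snd.comp Primrec.snd)
  have hsa := primrec_stepFn (primrec_unpair_fst.comp ha2) he ha1
  have hsb := primrec_stepFn (primrec_unpair_fst.comp hb2) he hb1
  have hla := primrec_listOf.comp (primrec_unpair_snd.comp ha2)
  have hlb := primrec_listOf.comp (primrec_unpair_snd.comp hb2)
  have hsb1 := Primrec.eq.comp hsb (Primrec.const (some 1))
  exact (Primrec.eq.comp hsa (Primrec.const none)).not.and <|
    (primrecPred_imp (primrecRel_isChild.comp (primrec_listOf.comp ha1) (primrec_listOf.comp hb1))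
      (primrecPred_imp (Primrec.eq.comp hsa (Primrec.const (some 1))) hsb1)).and <|
    (Primrec.eq.comp (Primrec.list_length.comp hla) ha1).and <|
    (primrecPred_imp (Primrec.eq.comp hb1 (Primrec.succ.comp ha1))
      (primrecRel_isChild.comp hlb hla)).and
    (primrecPred_imp (Primrec.eq.comp hb1 (primrec_unpair_snd.comp ha2)) hsb1)

theorem prefixClosed_of_isChild {T : Set (List ℕ)}
    (h : ∀ y x, IsChild y x → y ∈ T → x ∈ T) : PrefixClosed T := by
  rintro l hl l' ⟨t, rfl⟩
  induction t using List.reverseRecOn with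
  | nil => simpa using hl
  | append_singleton t a ih =>
    exact ih (h _ _ (isChild_append _ a) (by rwa [List.append_assoc]))

theorem not_mem_WF_iff {e : ℕ} : e ∉ WF ↔ ∃ f, LocPath (IllCond e) f := by
  have hWF : e ∉ WF ↔ IllFounded (treeAt e) := by simp [WF]
  rw [hWF]
  constructor
  · rintro ⟨g, hg⟩
    have hd : DecidesTree e := by
      by_contra hd
      simpa [treeAt, hd] using hg 0
    simp only [treeAt, if_pos hd] at hg
    have hv : ∀ n, ∃ v, codeFn e n = Part.some v := fun n =>
      ⟨_, (Part.some_get (hd.1 n)).symm⟩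
    choose v hv using hv
    have ht : ∀ n, ∃ t, stepFn t e n = some (v n) := fun n => codeFn_eq_some_iff.1 (hv n)
    choose t ht using ht
    have hone : ∀ n, stepFn (t n) e n = some 1 ↔ codeFn e n = Part.some 1 := by
      intro n
      rw [hv, ht]
      simp
    refine ⟨fun i => Nat.pair (t i) (Encodable.encode ((List.range i).map g)), fun i j => ?_⟩
    simp only [IllCond, Nat.unpair_pair, listOf_encode, hone]
    refine ⟨by simp [ht], fun hc h1 => ?_, by simp, fun hj => ?_, fun hj => ?_⟩
    · have := hd.2 (listOf i) (by simpa [encode_listOf] using h1) (listOf j)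
        (by rw [← hc.2]; exact List.take_prefix _ _)
      simpa [encode_listOf] using this
    · subst hj
      rw [List.range_succ, List.map_append]
      exact isChild_append _ _
    · rw [hj]
      exact hg i
  · rintro ⟨f, hf⟩
    have hd : DecidesTree e := by
      refine ⟨fun n => ?_, prefixClosed_of_isChild fun y x hyx hy => ?_⟩
      · obtain ⟨v, hv⟩ := Option.ne_none_iff_exists'.1 (hf n 0).1
        rw [codeFn_eq_some_iff.2 ⟨_, hv⟩]
        trivial
      · have hc := hf (Encodable.encode y) (Encodable.encode x)
        obtain ⟨v, hv⟩ := Option.ne_none_iff_exists'.1 hc.1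
        obtain ⟨t, ht⟩ := codeFn_eq_some_iff.1 hy
        have hv1 := eq_of_stepFn hv ht
        subst hv1
        exact codeFn_eq_some_iff.2 ⟨_, hc.2.1 (by simpa [listOf_encode] using hyx) hv⟩
    let L : ℕ → List ℕ := fun i => listOf (f i).unpair.2
    have hLlen : ∀ i, (L i).length = i := fun i => (hf i 0).2.2.1
    have hL : ∀ i, L i = (List.range i).map fun n => (L (n + 1)).getD n 0 := by
      intro i
      induction i with
      | zero => exact List.eq_nil_of_length_eq_zero (hLlen 0)
      | succ i ih =>
        obtain ⟨a, ha⟩ := isChild_iff.1 ((hf i (i + 1)).2.2.2.1 rfl)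
        change L (i + 1) = L i ++ [a] at ha
        rw [List.range_succ, List.map_append, ← ih, ha]
        simp [ha, hLlen i]
    refine ⟨fun n => (L (n + 1)).getD n 0, fun k => ?_⟩
    rw [← hL, treeAt, if_pos hd]
    refine codeFn_eq_some_iff.2 ⟨_, (hf k (Encodable.encode (L k))).2.2.2.2 ?_⟩
    exact encode_listOf _

/-- A finite oracle string is allowed if every `m` in it codes a pair with first entry
in `WF`. -/
def Allowed (τ : List Bool) : Prop := ∀ m : ℕ, τ[m]? = some true → m.unpair.1 ∈ WF

/-- Local condition whose solutions witness that `τ` is not allowed. -/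
def BadCond (τ : List Bool) (a b : ℕ × ℕ) : Prop :=
  a.2.unpair.1 = b.2.unpair.1 ∧ τ[a.2.unpair.1]? = some true ∧
    IllCond a.2.unpair.1.unpair.1 (a.1, a.2.unpair.2) (b.1, b.2.unpair.2)

theorem allowed_iff {τ : List Bool} : Allowed τ ↔ ¬ ∃ f, LocPath (BadCond τ) f := by
  rw [← not_iff_not, not_not]
  simp only [Allowed, not_forall]
  constructor
  · rintro ⟨m, hm, hWF⟩
    obtain ⟨f, hf⟩ := not_mem_WF_iff.1 hWF
    exact ⟨fun i => Nat.pair m (f i), fun i j => by simpa [BadCond, hm] using hf i j⟩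
  · rintro ⟨f, hf⟩
    refine ⟨(f 0).unpair.1, (hf 0 0).2.1, not_mem_WF_iff.2 ⟨fun i => (f i).unpair.2, fun i j => ?_⟩⟩
    rw [(hf 0 i).1]
    exact (hf i j).2.2

theorem primrecPred_badCond :
    PrimrecPred fun t : List Bool × (ℕ × ℕ) × (ℕ × ℕ) => BadCond t.1 t.2.1 t.2.2 := by
  have ha1 : Primrec fun t : List Bool × (ℕ × ℕ) × (ℕ × ℕ) => t.2.1.1 :=
    Primrec.fst.comp (Primrec.fst.comp Primrec.snd)
  have ha2 : Primrec fun t : List Bool × (ℕ × ℕ) × (ℕ × ℕ) => t.2.1.2 :=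
    Primrec.snd.comp (Primrec.fst.comp Primrec.snd)
  have hb1 : Primrec fun t : List Bool × (ℕ × ℕ) × (ℕ × ℕ) => t.2.2.1 :=
    Primrec.fst.comp (Primrec.snd.comp Primrec.snd)
  have hb2 : Primrec fun t : List Bool × (ℕ × ℕ) × (ℕ × ℕ) => t.2.2.2 :=
    Primrec.snd.comp (Primrec.snd.comp Primrec.snd)
  have hm := primrec_unpair_fst.comp ha2
  exact (Primrec.eq.comp hm (primrec_unpair_fst.comp hb2)).and <|
    (Primrec.eq.comp (Primrec.list_getElem?.comp Primrec.fst hm) (Primrec.const (some true))).and <|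
    primrecPred_illCond.comp (Primrec.pair (primrec_unpair_fst.comp hm)
      (Primrec.pair (Primrec.pair ha1 (primrec_unpair_snd.comp ha2))
        (Primrec.pair hb1 (primrec_unpair_snd.comp hb2))))

/-- A primitive recursive family of trees has, for each of its members depending on its own index,
an index computing it. -/
theorem exists_index {Q : ℕ → ℕ × ℕ → ℕ × ℕ → Prop}
    (hQ : PrimrecPred fun t : ℕ × (ℕ × ℕ) × (ℕ × ℕ) => Q t.1 t.2.1 t.2.2) :
    ∃ e, ∀ f, IsPath (treeAt e) f ↔ LocPath (Q e) f := by
  classical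
  have h1 : PrimrecRel fun (c : Code) (n : ℕ) => LocTree (Q (Encodable.encode c)) (listOf n) :=
    (primrecRel_locTree hQ).comp (Primrec.encode.comp Primrec.fst)
      (primrec_listOf.comp Primrec.snd)
  have h2 : Primrec₂ fun (c : Code) (n : ℕ) =>
      if LocTree (Q (Encodable.encode c)) (listOf n) then 1 else 0 :=
    Primrec.ite h1 (Primrec.const 1) (Primrec.const 0)
  obtain ⟨c, hc⟩ := Nat.Partrec.Code.fixed_point₂ (f := fun c n => Part.some
    (if LocTree (Q (Encodable.encode c)) (listOf n) then 1 else 0)) h2.to_comp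
  have hcode : ∀ n, codeFn (Encodable.encode c) n = Part.some
      (if LocTree (Q (Encodable.encode c)) (listOf n) then 1 else 0) := by
    intro n
    rw [codeFn, Denumerable.ofNat_encode, hc]
  have hmem : {l : List ℕ | codeFn (Encodable.encode c) (Encodable.encode l) = Part.some 1} =
      {l | LocTree (Q (Encodable.encode c)) l} := by
    ext l
    simp [hcode, listOf_encode]
  have hd : DecidesTree (Encodable.encode c) := by
    refine ⟨fun n => by rw [hcode]; trivial, ?_⟩
    rw [hmem]
    exact fun l hl l' hl' => LocTree.of_prefix hl hl'
  refine ⟨Encodable.encode c, fun f => ?_⟩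
  rw [treeAt, if_pos hd, hmem, locPath_iff]
  rfl

/-- The pair of a string and a number of steps with code `p`. -/
def runOf (p : ℕ) : List Bool × ℕ := (Encodable.decode p).getD ([], 0)

theorem runOf_encode (r : List Bool × ℕ) : runOf (Encodable.encode r) = r := by
  simp [runOf]

theorem primrec_runOf : Primrec runOf :=
  Primrec.option_getD.comp Primrec.decode (Primrec.const _)

/-- The output of the `p`-th run of `c` on input `e` with an oracle string extending `σ`. -/
def runVal (c : Code) (σ : List Bool) (e p : ℕ) : Option ℕ :=
  Nat.Partrec.Code.evaln (runOf p).2 c (Encodable.encode (σ ++ (runOf p).1, e))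

/-- The parity class of a possible first entry of a path. -/
def cls (v : ℕ) : Bool := v.unpair.1.unpair.1.bodd

/-- Local condition of the tree diagonalizing against `c` above `σ`. A solution names a parity
class and a run in the other class, and embeds the tree of that run in the trees of all runs in
the named class. -/
def DiagCond (c : Code) (σ : List Bool) (e : ℕ) (a b : ℕ × ℕ) : Prop :=
  a.2.unpair.1 = b.2.unpair.1 ∧
  (runVal c σ e a.2.unpair.1.unpair.2).map cls = some (!cls a.2) ∧
  (listOf a.1.unpair.2 = [] → listOf a.2.unpair.2 = []) ∧
  (a.1.unpair.1 = b.1.unpair.1 → (runVal c σ e a.1.unpair.1).map cls = some (cls a.2) →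
    IsChild (listOf b.1.unpair.2) (listOf a.1.unpair.2) →
    LocTree (BadCond (σ ++ (runOf a.2.unpair.1.unpair.2).1))
      ((listOf b.1.unpair.2).drop (cls a.2).toNat) →
    LocTree (BadCond (σ ++ (runOf a.1.unpair.1).1)) (listOf b.2.unpair.2) ∧
      IsChild (listOf b.2.unpair.2) (listOf a.2.unpair.2))

theorem primrec_runVal (c : Code) (σ : List Bool) : Primrec₂ (runVal c σ) :=
  have hr : Primrec fun t : ℕ × ℕ => runOf t.2 := primrec_runOf.comp Primrec.snd
  primrec_evaln (Primrec.snd.comp hr) (Primrec.const c) (Primrec.encode.comp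
    (Primrec.pair (Primrec.list_append.comp (Primrec.const σ) (Primrec.fst.comp hr)) Primrec.fst))

theorem primrec_cls : Primrec cls :=
  Primrec.nat_bodd.comp (primrec_unpair_fst.comp primrec_unpair_fst)

theorem primrecPred_diagCond (c : Code) (σ : List Bool) :
    PrimrecPred fun t : ℕ × (ℕ × ℕ) × (ℕ × ℕ) => DiagCond c σ t.1 t.2.1 t.2.2 := by
  have he : Primrec fun t : ℕ × (ℕ × ℕ) × (ℕ × ℕ) => t.1 := Primrec.fst
  have ha1 : Primrec fun t : ℕ × (ℕ × ℕ) × (ℕ × ℕ) => t.2.1.1 :=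
    Primrec.fst.comp (Primrec.fst.comp Primrec.snd)
  have ha2 : Primrec fun t : ℕ × (ℕ × ℕ) × (ℕ × ℕ) => t.2.1.2 :=
    Primrec.snd.comp (Primrec.fst.comp Primrec.snd)
  have hb1 : Primrec fun t : ℕ × (ℕ × ℕ) × (ℕ × ℕ) => t.2.2.1 :=
    Primrec.fst.comp (Primrec.snd.comp Primrec.snd)
  have hb2 : Primrec fun t : ℕ × (ℕ × ℕ) × (ℕ × ℕ) => t.2.2.2 :=
    Primrec.snd.comp (Primrec.snd.comp Primrec.snd)
  have hq := primrec_unpair_snd.comp (primrec_unpair_fst.comp ha2)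
  have hp := primrec_unpair_fst.comp ha1
  have hc := primrec_cls.comp ha2
  have hval : ∀ {u : ℕ × (ℕ × ℕ) × (ℕ × ℕ) → ℕ}, Primrec u →
      Primrec fun t => (runVal c σ t.1 (u t)).map cls := fun hu =>
    (Primrec.option_map₁ primrec_cls).comp ((primrec_runVal c σ).comp he hu)
  have htree : ∀ {u : ℕ × (ℕ × ℕ) × (ℕ × ℕ) → ℕ} {l : ℕ × (ℕ × ℕ) × (ℕ × ℕ) → List ℕ}, Primrec u →
      Primrec l → PrimrecPred fun t => LocTree (BadCond (σ ++ (runOf (u t)).1)) (l t) :=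
    fun hu hl => (primrecRel_locTree primrecPred_badCond).comp
      (Primrec.list_append.comp (Primrec.const σ) (Primrec.fst.comp (primrec_runOf.comp hu))) hl
  have hX := primrec_listOf.comp (primrec_unpair_snd.comp ha1)
  have hX' := primrec_listOf.comp (primrec_unpair_snd.comp hb1)
  have hY := primrec_listOf.comp (primrec_unpair_snd.comp ha2)
  have hY' := primrec_listOf.comp (primrec_unpair_snd.comp hb2)
  exact (Primrec.eq.comp (primrec_unpair_fst.comp ha2) (primrec_unpair_fst.comp hb2)).and <|
    (Primrec.eq.comp (hval hq)
      (Primrec.option_some.comp (Primrec.not.comp hc))).and <|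
    (primrecPred_imp (Primrec.eq.comp hX (Primrec.const []))
      (Primrec.eq.comp hY (Primrec.const []))).and <|
    primrecPred_imp (Primrec.eq.comp hp (primrec_unpair_fst.comp hb1)) <|
    primrecPred_imp (Primrec.eq.comp (hval hp) (Primrec.option_some.comp hc)) <|
    primrecPred_imp (primrecRel_isChild.comp hX' hX) <|
    primrecPred_imp (htree hq (Primrec.list_drop.comp ((Primrec.dom_bool Bool.toNat).comp hc) hX'))
      ((htree hp hY').and (primrecRel_isChild.comp hY' hY))

theorem exists_emb_of_diagCond {c : Code} {σ : List Bool} {e : ℕ} {f : ℕ → ℕ}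
    (hf : LocPath (DiagCond c σ e) f) :
    ∃ q, (runVal c σ e q).map cls = some (!cls (f 0)) ∧
      ∀ p, (runVal c σ e p).map cls = some (cls (f 0)) →
        ∃ G, Emb (BadCond (σ ++ (runOf q).1)) (BadCond (σ ++ (runOf p).1)) (cls (f 0)) G := by
  have hconst : ∀ i, (f i).unpair.1 = (f 0).unpair.1 := fun i => (hf i 0).1
  have hcls : ∀ i, cls (f i) = cls (f 0) := fun i => by rw [cls, hconst, cls]
  refine ⟨(f 0).unpair.1.unpair.2, (hf 0 0).2.1, fun p hp => ?_⟩
  refine ⟨fun x => listOf (f (Nat.pair p (Encodable.encode x))).unpair.2, ?_, fun y x hyx hy => ?_⟩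
  · exact (hf (Nat.pair p (Encodable.encode ([] : List ℕ))) 0).2.2.1
      (by rw [Nat.unpair_pair, listOf_encode])
  · have := (hf (Nat.pair p (Encodable.encode x)) (Nat.pair p (Encodable.encode y))).2.2.2
    simp only [Nat.unpair_pair, listOf_encode, hconst, hcls] at this
    exact this trivial hp hyx hy

theorem exists_locPath_diagCond {c : Code} {σ : List Bool} {e q : ℕ} {b : Bool}
    (hq : (runVal c σ e q).map cls = some (!b))
    (h : ∀ p, (runVal c σ e p).map cls = some b →
        ∃ G, Emb (BadCond (σ ++ (runOf q).1)) (BadCond (σ ++ (runOf p).1)) b G) :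
    ∃ f, LocPath (DiagCond c σ e) f := by
  have h' : ∀ p, ∃ G : List ℕ → List ℕ, G [] = [] ∧ ((runVal c σ e p).map cls = some b →
      Emb (BadCond (σ ++ (runOf q).1)) (BadCond (σ ++ (runOf p).1)) b G) := by
    intro p
    by_cases hp : (runVal c σ e p).map cls = some b
    · obtain ⟨G, hG⟩ := h p hp
      exact ⟨G, hG.1, fun _ => hG⟩
    · exact ⟨fun _ => [], rfl, fun h => absurd h hp⟩
  choose G hG0 hG using h'
  have hb : ∀ n, cls (Nat.pair (Nat.pair b.toNat q) n) = b := by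
    intro n
    cases b <;> simp [cls]
  refine ⟨fun i => Nat.pair (Nat.pair b.toNat q)
    (Encodable.encode (G i.unpair.1 (listOf i.unpair.2))), fun i j => ?_⟩
  simp only [DiagCond, hb, Nat.unpair_pair, listOf_encode]
  refine ⟨trivial, hq, fun h => by rw [h, hG0], fun hij hp hc ht => ?_⟩
  rw [← hij]
  exact (hG _ hp).2 _ _ hc ht

/-- Every allowed string has an allowed extension forcing that the functional `c` does not
compute the first entries of paths through all ill-founded computable trees. -/
theorem exists_allowed_forcing (c : Code) (σ : List Bool) (hσ : Allowed σ) :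
    ∃ τ, Allowed τ ∧ σ <+: τ ∧ ∃ e,
      (∀ τ', Allowed τ' → τ <+: τ' → ¬ (c.eval (Encodable.encode (τ', e))).Dom) ∨
      (IllFounded (treeAt e) ∧ ∃ v ∈ c.eval (Encodable.encode (τ, e)),
        ∀ f, IsPath (treeAt e) f → f 0 ≠ v) := by
  obtain ⟨e, he⟩ := exists_index (primrecPred_diagCond c σ)
  by_cases h : ∀ τ', Allowed τ' → σ <+: τ' → ¬ (c.eval (Encodable.encode (τ', e))).Dom
  · exact ⟨σ, hσ, List.prefix_rfl, e, Or.inl h⟩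
  push Not at h
  obtain ⟨τ, hτ, ⟨ρ, rfl⟩, hdom⟩ := h
  obtain ⟨s, hs⟩ := Nat.Partrec.Code.evaln_complete.1 (Part.get_mem hdom)
  obtain ⟨p, b, hp, hbad, hemb, hnemb⟩ := exists_selected
    (fun p => BadCond (σ ++ (runOf p).1)) (fun p => (runVal c σ e p).map cls)
    ⟨Encodable.encode (ρ, s), by simp only [runVal, runOf_encode]; rw [hs]; simp,
      by simpa only [runOf_encode] using allowed_iff.1 hτ⟩
  obtain ⟨v, hv, hvb⟩ := Option.map_eq_some_iff.1 hp
  refine ⟨σ ++ (runOf p).1, allowed_iff.2 hbad, List.prefix_append _ _, e, Or.inr ⟨?_, v,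
    Nat.Partrec.Code.evaln_sound hv, fun f hf hfv => ?_⟩⟩
  · obtain ⟨f, hf⟩ := exists_locPath_diagCond (b := !b) (by simpa using hp) hemb
    exact ⟨f, (he f).2 hf⟩
  · obtain ⟨q, hq, hq'⟩ := exists_emb_of_diagCond ((he f).1 hf)
    rw [hfv, hvb] at hq hq'
    exact hnemb q hq (hq' p hp)

/-- The first `k` values of the characteristic function of `X`. -/
noncomputable def initSeg (X : Set ℕ) (k : ℕ) : List Bool :=
  (List.range k).map fun n => chi X n == 1

theorem initSeg_prefix (X : Set ℕ) {k k' : ℕ} (h : k ≤ k') : initSeg X k <+: initSeg X k' := by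
  obtain ⟨d, rfl⟩ := Nat.exists_eq_add_of_le h
  rw [initSeg, initSeg, List.range_add, List.map_append]
  exact List.prefix_append _ _

/-- `φ` is a monotone partial computable approximation of `f` by finite parts of the oracle `X`. -/
structure Approximates (X : Set ℕ) (φ : List Bool → ℕ →. ℕ) (f : ℕ →. ℕ) : Prop where
  partrec : Partrec₂ φ
  mono : ∀ σ τ, σ <+: τ → ∀ n v, v ∈ φ σ n → v ∈ φ τ n
  sound : ∀ k n v, v ∈ φ (initSeg X k) n → v ∈ f n
  complete : ∀ n v, v ∈ f n → ∃ k, v ∈ φ (initSeg X k) n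

theorem Approximates.mono_initSeg {X : Set ℕ} {φ : List Bool → ℕ →. ℕ} {f : ℕ →. ℕ}
    (h : Approximates X φ f) {k k' : ℕ} (hk : k ≤ k') {n v : ℕ} (hv : v ∈ φ (initSeg X k) n) :
    v ∈ φ (initSeg X k') n :=
  h.mono _ _ (initSeg_prefix X hk) n v hv

theorem Approximates.of_partrec (X : Set ℕ) {f : ℕ →. ℕ} (hf : Partrec f) :
    Approximates X (fun _ => f) f where
  partrec := (hf.comp Computable.snd)
  mono _ _ _ _ _ h := h
  sound _ _ _ h := h
  complete _ _ h := ⟨0, h⟩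

theorem Approximates.oracle (X : Set ℕ) :
    Approximates X (fun σ n => ((σ[n]? : Option Bool).map Bool.toNat : Option ℕ))
      (chi X : ℕ →. ℕ) where
  partrec := Computable.ofOption ((Primrec.option_map₁ (Primrec.dom_bool Bool.toNat)).comp
    Primrec.list_getElem?).to_comp
  mono := by
    rintro σ _ ⟨t, rfl⟩ n v hv
    simp only [Part.mem_ofOption, Option.mem_def, Option.map_eq_some_iff] at hv ⊢
    obtain ⟨b, hb, rfl⟩ := hv
    exact ⟨b, by rw [List.getElem?_append_left (List.getElem?_eq_some_iff.1 hb).1, hb], rfl⟩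
  sound := by
    intro k n v hv
    simp only [Part.mem_ofOption, Option.mem_def, Option.map_eq_some_iff, initSeg,
      List.getElem?_map] at hv
    obtain ⟨b, ⟨m, hm, rfl⟩, rfl⟩ := hv
    have : m = n := by
      rw [List.getElem?_eq_some_iff] at hm
      obtain ⟨_, hm⟩ := hm
      simpa using hm.symm
    subst this
    by_cases hX : m ∈ X <;> simp [chi, hX]
  complete := by
    intro n v hv
    refine ⟨n + 1, ?_⟩
    have hv : v = chi X n := by simpa using hv
    subst hv
    simp only [Part.mem_ofOption, Option.mem_def, initSeg, List.getElem?_map]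
    by_cases hX : n ∈ X <;> simp [chi, hX]

theorem Approximates.pair {X : Set ℕ} {φ ψ : List Bool → ℕ →. ℕ} {f g : ℕ →. ℕ}
    (hf : Approximates X φ f) (hg : Approximates X ψ g) :
    Approximates X (fun σ n => Nat.pair <$> φ σ n <*> ψ σ n)
      (fun n => Nat.pair <$> f n <*> g n) where
  partrec := by
    have h1 : Partrec₂ fun (t : List Bool × ℕ) (a : ℕ) => (ψ t.1 t.2).map (Nat.pair a) :=
      (hg.partrec.comp (Computable.fst.comp Computable.fst)
        (Computable.snd.comp Computable.fst)).map
        (Primrec₂.natPair.to_comp.comp (Computable.snd.comp Computable.fst) Computable.snd)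
    refine (Partrec.bind (hf.partrec.comp Computable.fst Computable.snd) h1).of_eq fun t => ?_
    simp [Seq.seq, Part.bind_map]
  mono σ τ hστ n v hv := by
    simp only [Seq.seq, Part.map_eq_map, Part.mem_bind_iff, Part.mem_map_iff] at hv ⊢
    obtain ⟨_, ⟨a, ha, rfl⟩, b, hb, rfl⟩ := hv
    exact ⟨_, ⟨a, hf.mono _ _ hστ _ _ ha, rfl⟩, b, hg.mono _ _ hστ _ _ hb, rfl⟩
  sound k n v hv := by
    simp only [Seq.seq, Part.map_eq_map, Part.mem_bind_iff, Part.mem_map_iff] at hv ⊢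
    obtain ⟨_, ⟨a, ha, rfl⟩, b, hb, rfl⟩ := hv
    exact ⟨_, ⟨a, hf.sound _ _ _ ha, rfl⟩, b, hg.sound _ _ _ hb, rfl⟩
  complete n v hv := by
    simp only [Seq.seq, Part.map_eq_map, Part.mem_bind_iff, Part.mem_map_iff] at hv ⊢
    obtain ⟨_, ⟨a, ha, rfl⟩, b, hb, rfl⟩ := hv
    obtain ⟨k, hk⟩ := hf.complete _ _ ha
    obtain ⟨k', hk'⟩ := hg.complete _ _ hb
    exact ⟨max k k', _, ⟨a, hf.mono_initSeg (le_max_left _ _) hk, rfl⟩, b,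
      hg.mono_initSeg (le_max_right _ _) hk', rfl⟩

theorem Approximates.comp {X : Set ℕ} {φ ψ : List Bool → ℕ →. ℕ} {f g : ℕ →. ℕ}
    (hf : Approximates X φ f) (hg : Approximates X ψ g) :
    Approximates X (fun σ n => ψ σ n >>= φ σ) (fun n => g n >>= f) where
  partrec := Partrec.bind (hg.partrec.comp Computable.fst Computable.snd)
    (hf.partrec.comp (Computable.fst.comp Computable.fst) Computable.snd)
  mono σ τ hστ n v hv := by
    obtain ⟨a, ha, hv⟩ := Part.mem_bind_iff.1 hv
    exact Part.mem_bind_iff.2 ⟨a, hg.mono _ _ hστ _ _ ha, hf.mono _ _ hστ _ _ hv⟩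
  sound k n v hv := by
    obtain ⟨a, ha, hv⟩ := Part.mem_bind_iff.1 hv
    exact Part.mem_bind_iff.2 ⟨a, hg.sound _ _ _ ha, hf.sound _ _ _ hv⟩
  complete n v hv := by
    obtain ⟨a, ha, hv⟩ := Part.mem_bind_iff.1 hv
    obtain ⟨k, hk⟩ := hg.complete _ _ ha
    obtain ⟨k', hk'⟩ := hf.complete _ _ hv
    exact ⟨max k k', Part.mem_bind_iff.2 ⟨a, hg.mono_initSeg (le_max_left _ _) hk,
      hf.mono_initSeg (le_max_right _ _) hk'⟩⟩

/-- Primitive recursion of partial functions, as in `RecursiveIn.prec`. -/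
def precFn (f g : ℕ →. ℕ) : ℕ →. ℕ :=
  Nat.unpaired fun a n =>
    n.rec (f a) fun y IH => do let i ← IH; g (Nat.pair a (Nat.pair y i))

theorem mem_precFn_zero {f g : ℕ →. ℕ} {a v : ℕ} : v ∈ precFn f g (Nat.pair a 0) ↔ v ∈ f a := by
  simp [precFn]

theorem mem_precFn_succ {f g : ℕ →. ℕ} {a y v : ℕ} : v ∈ precFn f g (Nat.pair a (y + 1)) ↔
    ∃ i ∈ precFn f g (Nat.pair a y), v ∈ g (Nat.pair a (Nat.pair y i)) := by
  simp [precFn]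

theorem precFn_mono {f g f' g' : ℕ →. ℕ} (hf : ∀ n v, v ∈ f n → v ∈ f' n)
    (hg : ∀ n v, v ∈ g n → v ∈ g' n) (n v : ℕ) (hv : v ∈ precFn f g n) : v ∈ precFn f' g' n := by
  obtain ⟨a, y, rfl⟩ : ∃ a y, n = Nat.pair a y := ⟨_, _, (Nat.pair_unpair n).symm⟩
  induction y generalizing v with
  | zero => exact mem_precFn_zero.2 (hf _ _ (mem_precFn_zero.1 hv))
  | succ y ih =>
    obtain ⟨i, hi, hv⟩ := mem_precFn_succ.1 hv
    exact mem_precFn_succ.2 ⟨i, ih i hi, hg _ _ hv⟩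

theorem Approximates.prec {X : Set ℕ} {φ ψ : List Bool → ℕ →. ℕ} {f g : ℕ →. ℕ}
    (hf : Approximates X φ f) (hg : Approximates X ψ g) :
    Approximates X (fun σ => precFn (φ σ) (ψ σ)) (precFn f g) where
  partrec := by
    have h1 : Partrec₂ fun (t : List Bool × ℕ) (s : ℕ × ℕ) =>
        ψ t.1 (Nat.pair t.2.unpair.1 (Nat.pair s.1 s.2)) :=
      hg.partrec.comp (Computable.fst.comp Computable.fst)
        (Primrec₂.natPair.to_comp.comp
          (primrec_unpair_fst.to_comp.comp (Computable.snd.comp Computable.fst))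
          (Primrec₂.natPair.to_comp.comp (Computable.fst.comp Computable.snd)
            (Computable.snd.comp Computable.snd)))
    exact Partrec.nat_rec (primrec_unpair_snd.to_comp.comp Computable.snd)
      (hf.partrec.comp Computable.fst (primrec_unpair_fst.to_comp.comp Computable.snd)) h1
  mono σ τ hστ := precFn_mono (hf.mono _ _ hστ) (hg.mono _ _ hστ)
  sound k := precFn_mono (hf.sound k) (hg.sound k)
  complete n v hv := by
    obtain ⟨a, y, rfl⟩ : ∃ a y, n = Nat.pair a y := ⟨_, _, (Nat.pair_unpair n).symm⟩
    induction y generalizing v with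
    | zero =>
      obtain ⟨k, hk⟩ := hf.complete _ _ (mem_precFn_zero.1 hv)
      exact ⟨k, mem_precFn_zero.2 hk⟩
    | succ y ih =>
      obtain ⟨i, hi, hv⟩ := mem_precFn_succ.1 hv
      obtain ⟨k, hk⟩ := ih i hi
      obtain ⟨k', hk'⟩ := hg.complete _ _ hv
      exact ⟨max k k', mem_precFn_succ.2 ⟨i,
        precFn_mono (fun _ _ => hf.mono_initSeg (le_max_left k k'))
          (fun _ _ => hg.mono_initSeg (le_max_left k k')) _ _ hk,
        hg.mono_initSeg (le_max_right _ _) hk'⟩⟩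

/-- Unbounded search, as in `RecursiveIn.rfind`. -/
def rfindFn (f : ℕ →. ℕ) : ℕ →. ℕ :=
  fun a => Nat.rfind fun n => (fun m => m = 0) <$> f (Nat.pair a n)

theorem mem_rfindFn {f : ℕ →. ℕ} {a v : ℕ} : v ∈ rfindFn f a ↔
    0 ∈ f (Nat.pair a v) ∧ ∀ m < v, ∃ w ∈ f (Nat.pair a m), w ≠ 0 := by
  unfold rfindFn
  refine Nat.mem_rfind.trans ?_
  simp

theorem rfindFn_mono {f f' : ℕ →. ℕ} (hf : ∀ n v, v ∈ f n → v ∈ f' n) (n v : ℕ)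
    (hv : v ∈ rfindFn f n) : v ∈ rfindFn f' n := by
  rw [mem_rfindFn] at hv ⊢
  exact ⟨hf _ _ hv.1, fun m hm => let ⟨w, hw, h0⟩ := hv.2 m hm; ⟨w, hf _ _ hw, h0⟩⟩

theorem Approximates.rfind {X : Set ℕ} {φ : List Bool → ℕ →. ℕ} {f : ℕ →. ℕ}
    (hf : Approximates X φ f) : Approximates X (fun σ => rfindFn (φ σ)) (rfindFn f) where
  partrec := by
    have h1 : Partrec₂ fun (t : List Bool × ℕ) (n : ℕ) =>
        (φ t.1 (Nat.pair t.2 n)).map fun m => decide (m = 0) :=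
      (hf.partrec.comp (Computable.fst.comp Computable.fst)
        (Primrec₂.natPair.to_comp.comp (Computable.snd.comp Computable.fst)
          Computable.snd)).map
        ((Primrec.eq.comp Primrec.snd (Primrec.const 0)).decide.to_comp)
    exact Partrec.rfind h1
  mono σ τ hστ := rfindFn_mono (hf.mono _ _ hστ)
  sound k := rfindFn_mono (hf.sound k)
  complete n v hv := by
    obtain ⟨h0, hlt⟩ := mem_rfindFn.1 hv
    have hbound : ∀ u ≤ v, ∃ k, ∀ m < u, ∃ w ∈ φ (initSeg X k) (Nat.pair n m), w ≠ 0 := by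
      intro u hu
      induction u with
      | zero => exact ⟨0, fun m hm => absurd hm (Nat.not_lt_zero m)⟩
      | succ u ih =>
        obtain ⟨k, hk⟩ := ih (by omega)
        obtain ⟨w, hw, hw0⟩ := hlt u hu
        obtain ⟨k', hk'⟩ := hf.complete _ _ hw
        refine ⟨max k k', fun m hm => ?_⟩
        rcases Nat.lt_succ_iff_lt_or_eq.1 hm with h | rfl
        · obtain ⟨w', hw', h'⟩ := hk m h
          exact ⟨w', hf.mono_initSeg (le_max_left _ _) hw', h'⟩
        · exact ⟨w, hf.mono_initSeg (le_max_right _ _) hk', hw0⟩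
    obtain ⟨k, hk⟩ := hbound v le_rfl
    obtain ⟨k', hk'⟩ := hf.complete _ _ h0
    refine ⟨max k k', mem_rfindFn.2 ⟨hf.mono_initSeg (le_max_right _ _) hk', fun m hm => ?_⟩⟩
    obtain ⟨w', hw', h'⟩ := hk m hm
    exact ⟨w', hf.mono_initSeg (le_max_left _ _) hw', h'⟩

theorem RecursiveIn.exists_approximates {X : Set ℕ} {f : ℕ →. ℕ} (h : RecursiveIn (chi X) f) :
    ∃ φ, Approximates X φ f := by
  induction h with
  | zero => exact ⟨_, .of_partrec X (Partrec.nat_iff.2 Nat.Partrec.zero)⟩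
  | succ => exact ⟨_, .of_partrec X (Partrec.nat_iff.2 Nat.Partrec.succ)⟩
  | left => exact ⟨_, .of_partrec X (Partrec.nat_iff.2 Nat.Partrec.left)⟩
  | right => exact ⟨_, .of_partrec X (Partrec.nat_iff.2 Nat.Partrec.right)⟩
  | oracle => exact ⟨_, .oracle X⟩
  | pair _ _ hf hg => exact ⟨_, hf.choose_spec.pair hg.choose_spec⟩
  | comp _ _ hf hg => exact ⟨_, hf.choose_spec.comp hg.choose_spec⟩
  | prec _ _ hf hg => exact ⟨_, hf.choose_spec.prec hg.choose_spec⟩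
  | rfind _ hf => exact ⟨_, hf.choose_spec.rfind⟩

theorem RecursiveIn.of_partrec (O : ℕ → ℕ) {f : ℕ →. ℕ} (h : Nat.Partrec f) : RecursiveIn O f := by
  induction h with
  | zero => exact .zero
  | succ => exact .succ
  | left => exact .left
  | right => exact .right
  | pair _ _ hf hg => exact .pair hf hg
  | comp _ _ hf hg => exact .comp hf hg
  | prec _ _ hf hg => exact .prec hf hg
  | rfind _ hf => exact .rfind hf

theorem RecursiveIn.partrecIn {O : ℕ → ℕ} {f : ℕ →. ℕ} (h : RecursiveIn O f) : PartrecIn O f := by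
  have heq : (fun n : ℕ => Part.bind (Part.ofOption (Encodable.decode (α := ℕ) n)) fun a =>
      (f a).map Encodable.encode) = f := by
    funext n
    rw [Encodable.decode_nat]
    exact (Part.bind_some _ _).trans (Part.map_id' (fun _ => rfl) _)
  rwa [PartrecIn, heq]

theorem ceIn_of_forall_iff {X A : Set ℕ} (h : ∀ n, n ∈ A ↔ ∃ m, Nat.pair n m ∈ X) : CEIn X A := by
  have hsub : RecursiveIn (chi X) fun n => Part.some (1 - n) :=
    .of_partrec _ (Partrec.nat_iff.1
      (Primrec.nat_sub.comp (Primrec.const 1) Primrec.id).to_comp.partrec)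
  have hcomp : RecursiveIn (chi X) fun n => Part.some (1 - chi X n) := by
    have heq : (fun n => (chi X : ℕ →. ℕ) n >>= (fun n => Part.some (1 - n) : ℕ →. ℕ)) =
        fun n => Part.some (1 - chi X n) :=
      funext fun n => Part.bind_some _ _
    exact heq ▸ hsub.comp .oracle
  refine ⟨rfindFn fun n => Part.some (1 - chi X n), RecursiveIn.partrecIn hcomp.rfind,
    fun n => ?_⟩
  rw [h, Part.dom_iff_mem]
  constructor
  · intro hm
    classical
    refine ⟨Nat.find hm, mem_rfindFn.2 ⟨Part.mem_some_iff.2 ?_, fun m hlt =>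
      ⟨1, Part.mem_some_iff.2 ?_, one_ne_zero⟩⟩⟩
    · simp [chi, Nat.find_spec hm]
    · simp [chi, Nat.find_min hm hlt]
  · rintro ⟨m, hm⟩
    refine ⟨m, ?_⟩
    have h0 := Part.mem_some_iff.1 (mem_rfindFn.1 hm).1
    by_contra hX
    simp [chi, hX] at h0

theorem Allowed.append {τ : List Bool} (h : Allowed τ) {ρ : List Bool}
    (hρ : ∀ m : ℕ, ρ[m]? = some true → (τ.length + m).unpair.1 ∈ WF) : Allowed (τ ++ ρ) := by
  intro m hm
  rcases Nat.lt_or_ge m τ.length with hlt | hge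
  · exact h m (by rwa [List.getElem?_append_left hlt] at hm)
  · rw [List.getElem?_append_right hge] at hm
    have := hρ _ hm
    rwa [Nat.add_sub_cancel' hge] at this

theorem exists_allowed_enumerating (σ : List Bool) (hσ : Allowed σ) {e : ℕ} (he : e ∈ WF) :
    ∃ τ, Allowed τ ∧ σ <+: τ ∧ ∃ m, τ[Nat.pair e m]? = some true := by
  have hlen : σ.length ≤ Nat.pair e σ.length := Nat.right_le_pair _ _
  have hlen' : (σ ++ List.replicate (Nat.pair e σ.length - σ.length) false).length =
      Nat.pair e σ.length := by
    simp; omega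
  have h1 : Allowed (σ ++ List.replicate (Nat.pair e σ.length - σ.length) false) :=
    hσ.append fun m hm => by simp [List.getElem?_replicate] at hm
  refine ⟨_, h1.append (ρ := [true]) fun m hm => ?_,
    (List.prefix_append _ _).trans (List.prefix_append _ _), σ.length, ?_⟩
  · rw [hlen']
    obtain rfl : m = 0 := by
      by_contra h0
      rw [List.getElem?_eq_none (by simp; omega)] at hm
      simp at hm
    simpa using he
  · rw [List.getElem?_append_right hlen'.le, hlen', Nat.sub_self]
    rfl

/-- The string `τ` forces the functional `c` not to compute first entries of paths. -/
def Forces (c : Code) (τ : List Bool) : Prop :=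
  ∃ e, (∀ τ', Allowed τ' → τ <+: τ' → ¬ (c.eval (Encodable.encode (τ', e))).Dom) ∨
    (IllFounded (treeAt e) ∧ ∃ v ∈ c.eval (Encodable.encode (τ, e)),
      ∀ f, IsPath (treeAt e) f → f 0 ≠ v)

theorem exists_generic_step (n : ℕ) (σ : List Bool) (hσ : Allowed σ) :
    ∃ τ, Allowed τ ∧ (∃ τ₀, σ <+: τ₀ ∧ τ₀ <+: τ ∧ Forces (Denumerable.ofNat Code n) τ₀) ∧
      σ.length < τ.length ∧ (n ∈ WF → ∃ m, τ[Nat.pair n m]? = some true) := by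
  obtain ⟨τ₀, h₀, hσ₀, hF⟩ := exists_allowed_forcing (Denumerable.ofNat Code n) σ hσ
  have hlen := hσ₀.length_le
  have h₁ : Allowed (τ₀ ++ [false]) := h₀.append fun m hm => by
    cases m <;> simp at hm
  by_cases hn : n ∈ WF
  · obtain ⟨τ, hτ, hpre, hm⟩ := exists_allowed_enumerating _ h₁ hn
    have := hpre.length_le
    exact ⟨τ, hτ, ⟨τ₀, hσ₀, (List.prefix_append _ _).trans hpre, hF⟩,
      by simp at this; omega, fun _ => hm⟩
  · exact ⟨_, h₁, ⟨τ₀, hσ₀, List.prefix_append _ _, hF⟩, by simp; omega, fun h => absurd h hn⟩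

/-- A sufficiently generic set enumerating `WF`. -/
theorem exists_generic : ∃ X : Set ℕ, (∀ e, e ∈ WF ↔ ∃ m, Nat.pair e m ∈ X) ∧
    (∀ k, Allowed (initSeg X k)) ∧ ∀ c, ∃ k, Forces c (initSeg X k) := by
  choose! next hnext using exists_generic_step
  let s : ℕ → List Bool := fun n => Nat.rec [] (fun n σ => next n σ) n
  have hs : ∀ n, Allowed (s n) := by
    intro n
    induction n with
    | zero => exact fun m hm => by simp [s] at hm
    | succ n ih => exact (hnext n (s n) ih).1
  have hstep : ∀ n, s n <+: s (n + 1) := fun n =>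
    let ⟨_, h1, h2, _⟩ := (hnext n (s n) (hs n)).2.1
    h1.trans h2
  have hmono : ∀ n k, s n <+: s (n + k) := by
    intro n k
    induction k with
    | zero => exact List.prefix_rfl
    | succ k ih => exact ih.trans (hstep _)
  have hlen : ∀ n, n ≤ (s n).length := by
    intro n
    induction n with
    | zero => simp
    | succ n ih => exact Nat.succ_le_of_lt (ih.trans_lt (hnext n (s n) (hs n)).2.2.1)
  let X : Set ℕ := {m | (s (m + 1))[m]? = some true}
  have hget : ∀ n, ∀ m < (s n).length, ((s n)[m]? = some true ↔ m ∈ X) := by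
    intro n m hm
    have hm' := hlen (m + 1)
    have h1 : (s n)[m]? = (s (n + (m + 1)))[m]? := by
      obtain ⟨t, ht⟩ := hmono n (m + 1)
      rw [← ht, List.getElem?_append_left hm]
    have h2 : (s (m + 1))[m]? = (s (n + (m + 1)))[m]? := by
      obtain ⟨t, ht⟩ := hmono (m + 1) n
      rw [add_comm n, ← ht, List.getElem?_append_left (by omega)]
    rw [h1, ← h2]
    rfl
  have hinit : ∀ n, initSeg X (s n).length = s n := by
    intro n
    refine List.ext_getElem (by simp [initSeg]) fun m h1 h2 => ?_
    have := hget n m h2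
    rw [List.getElem?_eq_getElem h2, Option.some_inj] at this
    rw [Bool.eq_iff_iff, this]
    by_cases hX : m ∈ X <;> simp [initSeg, chi, hX]
  have hinit' : ∀ τ n, τ <+: s n → initSeg X τ.length = τ := by
    intro τ n h
    have h1 := initSeg_prefix X h.length_le
    rw [hinit] at h1
    exact (List.prefix_of_prefix_length_le h1 h (by simp [initSeg])).eq_of_length
      (by simp [initSeg])
  have hX : ∀ m ∈ X, m.unpair.1 ∈ WF := fun m hm => hs (m + 1) m hm
  refine ⟨X, fun e => ⟨fun he => ?_, fun ⟨m, hm⟩ => by simpa using hX _ hm⟩, fun k m hm => ?_,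
    fun c => ?_⟩
  · obtain ⟨m, hm⟩ := (hnext e (s e) (hs e)).2.2.2 he
    exact ⟨m, (hget (e + 1) _ (List.getElem?_eq_some_iff.1 hm).1).1 hm⟩
  · refine hs k m ?_
    have h1 := initSeg_prefix X (hlen k)
    rw [hinit] at h1
    obtain ⟨t, ht⟩ := h1
    rw [← ht, List.getElem?_append_left (List.getElem?_eq_some_iff.1 hm).1, hm]
  · obtain ⟨τ₀, -, h2, hF⟩ := (hnext (Encodable.encode c) _ (hs (Encodable.encode c))).2.1
    rw [Denumerable.ofNat_encode] at hF
    exact ⟨τ₀.length, by rwa [hinit' τ₀ (Encodable.encode c + 1) h2]⟩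

/-- There is a set `X` such that `WF` is c.e. in `X`, but `X` is not
loquaciously high for paths. -/
theorem exists_enumerates_WF_not_loqHighForPaths :
    ∃ X : Set ℕ, CEIn X WF ∧ ¬ LoqHighForPaths X := by
  obtain ⟨X, hWF, hallowed, hforce⟩ := exists_generic
  refine ⟨X, ceIn_of_forall_iff hWF, ?_⟩
  rintro ⟨F, hF, hpath⟩
  obtain ⟨φ, hφ⟩ := RecursiveIn.exists_approximates hF
  have hval : ∀ e v, v ∈ (Part.bind (Part.ofOption
      (Encodable.decode (α := ℕ × ℕ) (Encodable.encode (e, 0)))) fun a =>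
      ((F : ℕ × ℕ →. ℕ) a).map Encodable.encode) ↔ v = F (e, 0) := by
    intro e v
    rw [Encodable.encodek]
    simp
  have hψ : Partrec₂ fun (τ : List Bool) (e : ℕ) => φ τ (Encodable.encode (e, 0)) :=
    hφ.partrec.comp Computable.fst
      (Computable.encode.comp (Computable.pair Computable.snd (Computable.const 0)))
  obtain ⟨c, hc⟩ := Nat.Partrec.Code.exists_code.1 hψ
  have hceval : ∀ (τ : List Bool) (e v : ℕ),
      v ∈ c.eval (Encodable.encode (τ, e)) ↔ v ∈ φ τ (Encodable.encode (e, 0)) := by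
    intro τ e v
    have h1 : c.eval (Encodable.encode (τ, e)) =
        (φ τ (Encodable.encode (e, 0))).map Encodable.encode := by
      rw [hc]
      beta_reduce
      rw [Encodable.encodek]
      exact Part.bind_some _ _
    rw [h1]
    exact Iff.of_eq (congrArg (v ∈ ·) (Part.map_id' (fun _ => rfl) _))
  obtain ⟨k, e, hdiv | ⟨hill, v, hv, hne⟩⟩ := hforce c
  · obtain ⟨k', hk'⟩ := hφ.complete _ _ ((hval e _).2 rfl)
    refine hdiv (initSeg X (max k k')) (hallowed _) (initSeg_prefix X (le_max_left _ _)) ?_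
    exact Part.dom_iff_mem.2 ⟨_, (hceval _ _ _).2 (hφ.mono_initSeg (le_max_right _ _) hk')⟩
  · have := (hval e v).1 (hφ.sound _ _ _ ((hceval _ _ _).1 hv))
    exact hne _ (hpath e hill) this.symm

end CFT
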